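/- For n ≥ 0, let P_n(z) = Σ_{ζ ∈ Q_{n+1}} z^{⌊(c(ζρ_{n+1})−1)/2⌋} be the IO-polynomial of an (n+1)-cycle, where ζρ_{n+1} is the composite applying ζ first and then ρ_{n+1}. Then P_0(z) = P_1(z) = 1, and for all n ≥ 2, (n+2)·P_n(z) = (2n+1)·z^{e(n)}·P_{n−1}(z) + (n−1)·(n² − z)·P_{n−2}(z), where e(n) = 1 if n is even and e(n) = 0 if n is odd. -/

import Mathlib

open Finset Polynomial

/-- Number of cycles of a permutation, counting fixed points as cycles of length 1
(equivalently, the number of orbits). -/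
noncomputable def cycleCount {α : Type*} [Fintype α] [DecidableEq α] (σ : Equiv.Perm α) : ℕ :=
  σ.cycleType.card + (Finset.univ.filter fun x => σ x = x).card

/-- The IO-polynomial `F_π(z) = Σ_{ζ ∈ Q_n} z^⌊(c(ζπ)-1)/2⌋`, where `Q_n` is the set of
`n`-cycles of `S_n` (i.e. permutations with a single cycle), and `ζπ` applies `ζ` first
and then `π`. -/
noncomputable def IOPoly {n : ℕ} (π : Equiv.Perm (Fin n)) : Polynomial ℝ :=
  ∑ ζ ∈ Finset.univ.filter (fun ζ : Equiv.Perm (Fin n) => cycleCount ζ = 1),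
    Polynomial.X ^ ((cycleCount (π * ζ) - 1) / 2)
/-- `P_n(z) = Σ_{ζ ∈ Q_{n+1}} z^⌊(c(ζρ_{n+1})-1)/2⌋`, the IO-polynomial of the
`(n+1)`-cycle `ρ_{n+1}`, where `ζρ_{n+1}` applies `ζ` first and then `ρ_{n+1}`. -/
noncomputable def Pn (n : ℕ) : Polynomial ℝ :=
  ∑ ζ ∈ Finset.univ.filter (fun ζ : Equiv.Perm (Fin (n + 1)) => cycleCount ζ = 1),
    Polynomial.X ^ ((cycleCount (finRotate (n + 1) * ζ) - 1) / 2)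

open Equiv Equiv.Perm

lemma SameCycle.apply_eq_of_invariant {α β : Type*} [Finite α] {σ : Perm α} {f : α → β}
    (hf : ∀ x, f (σ x) = f x) {x y : α} (h : SameCycle σ x y) : f x = f y := by
  obtain ⟨i, -, rfl⟩ := h.exists_pow_eq'
  induction i with
  | zero => rfl
  | succ i ih => rw [pow_succ', Perm.mul_apply, hf, ← ih ⟨i, rfl⟩]

section CycleCount

variable {α : Type*} [Fintype α] [DecidableEq α]

lemma cycleCount_add_sum (σ : Perm α) :
    cycleCount σ + σ.cycleType.sum = σ.cycleType.card + Fintype.card α := by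
  have h : (univ.filter fun x => σ x = x) = σ.supportᶜ := by
    ext x
    simp
  have h2 := σ.sum_cycleType_le
  rw [cycleCount, h, card_compl, ← sum_cycleType]
  omega

lemma cycleCount_congr {β : Type*} [Fintype β] [DecidableEq β] {σ : Perm α} {τ : Perm β}
    (h : σ.cycleType = τ.cycleType) (hc : Fintype.card α = Fintype.card β) :
    cycleCount σ = cycleCount τ := by
  have h1 := cycleCount_add_sum σ
  have h2 := cycleCount_add_sum τ
  rw [h] at h1
  omega

lemma cycleCount_conj (σ τ : Perm α) : cycleCount (τ * σ * τ⁻¹) = cycleCount σ :=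
  cycleCount_congr cycleType_conj rfl

lemma cycleCount_mul_comm (σ τ : Perm α) : cycleCount (σ * τ) = cycleCount (τ * σ) := by
  rw [← cycleCount_conj (σ * τ) τ]
  congr 1
  group

lemma sign_eq_neg_one_pow_cycleCount (σ : Perm α) :
    sign σ = (-1) ^ (Fintype.card α + cycleCount σ) := by
  have h := cycleCount_add_sum σ
  rw [sign_of_cycleType]
  refine (neg_one_pow_congr ?_)
  rw [Nat.even_add, Nat.even_add]
  have h' := congrArg Even h
  rw [Nat.even_add, Nat.even_add] at h'
  have h'' : _ ↔ _ := iff_of_eq h'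
  tauto

lemma cycleCount_subtypeCongr (p : α → Prop) [DecidablePred p] (u : Perm {a // p a})
    (v : Perm {a // ¬ p a}) :
    cycleCount (Perm.subtypeCongr u v) = cycleCount u + cycleCount v := by
  have h : Perm.subtypeCongr u v = ofSubtype u * ofSubtype v := by
    ext x
    by_cases hx : p x
    · rw [Perm.subtypeCongr.left_apply _ _ hx, Perm.mul_apply,
        ofSubtype_apply_of_not_mem v (by simpa using hx), ofSubtype_apply_of_mem u hx]
    · rw [Perm.subtypeCongr.right_apply _ _ hx, Perm.mul_apply, ofSubtype_apply_of_mem v hx,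
        ofSubtype_apply_of_not_mem u (v ⟨x, hx⟩).2]
  have hd : Perm.Disjoint (ofSubtype u) (ofSubtype v) := by
    intro x
    by_cases hx : p x
    · exact Or.inr (ofSubtype_apply_of_not_mem v (by simpa using hx))
    · exact Or.inl (ofSubtype_apply_of_not_mem u hx)
  have h0 := cycleCount_add_sum (Perm.subtypeCongr u v)
  have h1 := cycleCount_add_sum u
  have h2 := cycleCount_add_sum v
  rw [h, hd.cycleType_mul, cycleType_ofSubtype, cycleType_ofSubtype, Multiset.sum_add,
    Multiset.card_add, ← h] at h0
  have h3 := Fintype.card_subtype_compl p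
  have h4 := Fintype.card_subtype_le p
  omega

lemma cycleCount_optionCongr (σ : Perm α) : cycleCount σ.optionCongr = cycleCount σ + 1 := by
  have h : σ.optionCongr = σ.extendDomain (optionIsSomeEquiv α).symm := by
    ext1 x
    cases x with
    | none => rw [extendDomain_apply_not_subtype _ _ (by simp)]; simp
    | some x => rw [extendDomain_apply_subtype _ _ (by simp)]; simp [optionIsSomeEquiv]
  have h0 := cycleCount_add_sum σ.optionCongr
  have h1 := cycleCount_add_sum σ
  rw [h, cycleType_extendDomain, ← h, Fintype.card_option] at h0
  omega

lemma cycleCount_eq_card_quotient (σ : Perm α) :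
    cycleCount σ = Nat.card (Quotient (SameCycle.setoid σ)) := by
  have hne : ∀ f : σ.cycleFactorsFinset, ∃ x, x ∈ f.1.support := fun f => by
    obtain ⟨x, hx⟩ := (mem_cycleFactorsFinset_iff.1 f.2).1.nonempty_support
    exact ⟨x, hx⟩
  choose r hr using hne
  have hcyc : ∀ f : σ.cycleFactorsFinset, f.1 = σ.cycleOf (r f) := fun f =>
    cycle_is_cycleOf (hr f) f.2
  have hfix : ∀ f : σ.cycleFactorsFinset, σ (r f) ≠ r f := fun f =>
    mem_support.1 (mem_cycleFactorsFinset_support_le f.2 (hr f))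
  let g : σ.cycleFactorsFinset ⊕ {x // x ∈ univ.filter fun x => σ x = x} →
      Quotient (SameCycle.setoid σ) :=
    Sum.elim (fun f => Quotient.mk _ (r f)) (fun x => Quotient.mk _ x.1)
  have hg : Function.Bijective g := by
    constructor
    · rintro (f | x) (f' | x') h
      · have h' : SameCycle σ (r f) (r f') := Quotient.exact h
        rw [Sum.inl.injEq, Subtype.ext_iff, hcyc f, hcyc f', h'.cycleOf_eq]
      · have h' : SameCycle σ (r f) x'.1 := Quotient.exact h
        have hx := (mem_filter.1 x'.2).2
        exact absurd (h'.apply_eq_self_iff.2 hx) (hfix f)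
      · have h' : SameCycle σ x.1 (r f') := Quotient.exact h
        have hx := (mem_filter.1 x.2).2
        exact absurd (h'.apply_eq_self_iff.1 hx) (hfix f')
      · have h' : SameCycle σ x.1 x'.1 := Quotient.exact h
        have hx := (mem_filter.1 x.2).2
        rw [Sum.inr.injEq, Subtype.ext_iff]
        exact h'.eq_of_left hx
    · intro q
      induction q using Quotient.inductionOn with
      | h x =>
        by_cases hx : σ x = x
        · exact ⟨Sum.inr ⟨x, by simpa using hx⟩, rfl⟩
        · let f : σ.cycleFactorsFinset :=
            ⟨σ.cycleOf x, cycleOf_mem_cycleFactorsFinset_iff.2 (mem_support.2 hx)⟩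
          refine ⟨Sum.inl f, Quotient.sound ?_⟩
          exact (mem_support_cycleOf_iff.1 (hr f)).1.symm
  rw [← Nat.card_congr (Equiv.ofBijective g hg), Nat.card_sum, Nat.card_eq_fintype_card,
    Nat.card_eq_fintype_card, Fintype.card_coe, Fintype.card_coe, cycleCount, cycleType_def,
    Multiset.card_map]
  rfl

lemma cycleCount_swap_mul {σ : Perm α} {a b : α} (hab : ¬ SameCycle σ a b) :
    cycleCount (swap a b * σ) + 1 = cycleCount σ := by
  classical
  set τ := swap a b * σ with hτ
  have hτx : ∀ x, τ x = swap a b (σ x) := fun x => rfl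
  have hpow : ∀ i : ℕ, SameCycle τ a ((σ ^ i) a) := by
    intro i
    induction i with
    | zero => exact SameCycle.rfl
    | succ i ih =>
      have h1 : (σ ^ (i + 1)) a = σ ((σ ^ i) a) := by rw [pow_succ']; rfl
      have h2 := hτx ((σ ^ i) a)
      rw [← h1] at h2
      by_cases ha : (σ ^ (i + 1)) a = a
      · rw [ha]
      · have hb : (σ ^ (i + 1)) a ≠ b := fun hb => hab ⟨(i + 1 : ℕ), by rw [zpow_natCast, hb]⟩
        rw [swap_apply_of_ne_of_ne ha hb] at h2
        rw [← h2]
        exact sameCycle_apply_right.2 ih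
  have hτab : SameCycle τ a b := by
    have h1 : SameCycle σ a (σ⁻¹ a) := ⟨-1, by simp⟩
    obtain ⟨i, -, hi⟩ := h1.exists_pow_eq'
    have h2 := sameCycle_apply_right.2 (hpow i)
    rw [hi, hτx] at h2
    simpa using h2
  have hσ : ∀ x, SameCycle τ x (σ x) := by
    intro x
    have h1 : SameCycle τ x (swap a b (σ x)) := sameCycle_apply_right.2 SameCycle.rfl
    by_cases ha : σ x = a
    · rw [ha] at h1 ⊢
      rw [swap_apply_left] at h1
      exact h1.trans hτab.symm
    by_cases hb : σ x = b
    · rw [hb] at h1 ⊢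
      rw [swap_apply_right] at h1
      exact h1.trans hτab
    rwa [swap_apply_of_ne_of_ne ha hb] at h1
  let f : α → Quotient (SameCycle.setoid σ) := fun x =>
    if SameCycle σ a x then Quotient.mk _ b else Quotient.mk _ x
  have hfσ : ∀ x, f (σ x) = f x := by
    intro x
    simp only [f, sameCycle_apply_right]
    split_ifs
    · rfl
    · exact Quotient.sound (sameCycle_apply_left.2 SameCycle.rfl)
  have hfab : f a = f b := by
    simp only [f, if_neg hab, if_pos (SameCycle.refl σ a)]
  have hfτ : ∀ x, f (τ x) = f x := by
    intro x
    rw [hτx, ← hfσ x, swap_apply_def]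
    split_ifs with h1 h2
    · rw [h1, hfab]
    · rw [h2, hfab]
    · rfl
  have hfne : ∀ x, f x ≠ Quotient.mk _ a := by
    intro x hx
    simp only [f] at hx
    split_ifs at hx with h
    · exact hab (SameCycle.symm (Quotient.exact hx))
    · exact h (SameCycle.symm (Quotient.exact hx))
  let e : Quotient (SameCycle.setoid τ) ≃
      {q : Quotient (SameCycle.setoid σ) // q ≠ Quotient.mk _ a} :=
    { toFun := fun q => ⟨Quotient.lift f
        (fun x y h => SameCycle.apply_eq_of_invariant hfτ h) q, by
          induction q using Quotient.inductionOn with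
          | h x => exact hfne x⟩
      invFun := fun q => Quotient.lift (fun x => Quotient.mk (SameCycle.setoid τ) x)
        (fun x y h => SameCycle.apply_eq_of_invariant
          (fun x => Quotient.sound (hσ x).symm) h) q.1
      left_inv := by
        intro q
        induction q using Quotient.inductionOn with
        | h x =>
          by_cases h : SameCycle σ a x
          · simp only [Quotient.lift_mk, f, if_pos h]
            refine Quotient.sound (hτab.symm.trans ?_)
            obtain ⟨i, -, hi⟩ := h.exists_pow_eq'
            rw [← hi]
            exact hpow i
          · simp only [Quotient.lift_mk, f, if_neg h]
      right_inv := by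
        rintro ⟨q, hq⟩
        induction q using Quotient.inductionOn with
        | h x =>
          have h : ¬ SameCycle σ a x := fun h => hq (Quotient.sound h.symm)
          simp only [Quotient.lift_mk, f, if_neg h] }
  rw [cycleCount_eq_card_quotient τ, cycleCount_eq_card_quotient σ, Nat.card_congr e]
  have := Fintype.card_subtype_compl (fun q : Quotient (SameCycle.setoid σ) => q = Quotient.mk _ a)
  rw [Fintype.card_subtype_eq] at this
  have h0 : 0 < Fintype.card (Quotient (SameCycle.setoid σ)) :=
    Fintype.card_pos_iff.2 ⟨Quotient.mk _ a⟩
  rw [Nat.card_eq_fintype_card, Nat.card_eq_fintype_card]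
  change Fintype.card {q // ¬ q = _} + 1 = _
  omega

end CycleCount

section Rising

variable {R : Type*} [CommRing R]

/-- The rising factorial `x (x + 1) ⋯ (x + m - 1)`. -/
def rising (m : ℕ) (x : R) : R := ∏ i ∈ range m, (x + i)

lemma rising_zero (x : R) : rising 0 x = 1 := by simp [rising]

lemma rising_succ (m : ℕ) (x : R) : rising (m + 1) x = rising m x * (x + m) :=
  prod_range_succ _ _

lemma sum_pow_cycleCount (α : Type*) [Fintype α] [hα : DecidableEq α] (x : R) :
    ∑ σ : Perm α, x ^ cycleCount σ = rising (Fintype.card α) x := by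
  suffices h : ∀ hα : DecidableEq α,
      ∑ σ : Perm α, x ^ cycleCount σ = rising (Fintype.card α) x from h hα
  refine Fintype.induction_empty_option (P := fun (α : Type _) [Fintype α] =>
    ∀ hα : DecidableEq α, ∑ σ : Perm α, x ^ cycleCount σ = rising (Fintype.card α) x)
    ?_ ?_ ?_ α
  · intro α β _ e h hβ
    let := Fintype.ofEquiv β e.symm
    let : DecidableEq α := Classical.decEq α
    rw [← Fintype.card_congr e, ← h inferInstance]
    refine (Fintype.sum_equiv (Equiv.permCongr e) _ _ fun σ => ?_).symm
    congr 1
    rw [cycleCount_eq_card_quotient, cycleCount_eq_card_quotient]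
    refine Nat.card_congr (Quotient.congr e fun a b => ?_)
    change SameCycle σ a b ↔ SameCycle (e.permCongr σ) (e a) (e b)
    have h1 : ∀ i : ℤ, ((e.permCongr σ) ^ i) (e a) = e ((σ ^ i) a) := fun i => by
      have := map_zpow (permCongrHom e) σ i
      change e.permCongr (σ ^ i) = (e.permCongr σ) ^ i at this
      rw [← this]
      simp
    simp only [SameCycle, h1, EmbeddingLike.apply_eq_iff_eq]
  · intro h
    simp [rising, cycleCount]
  · intro α _ ih hα
    let : DecidableEq α := Classical.decEq α
    have hα' : hα = Option.instDecidableEq := Subsingleton.elim _ _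
    subst hα'
    rw [Fintype.card_option, rising_succ, ← ih inferInstance,
      ← Equiv.sum_comp decomposeOption.symm, Fintype.sum_prod_type, Fintype.sum_option, mul_add,
      sum_mul, sum_mul]
    congr 1
    · refine sum_congr rfl fun σ _ => ?_
      rw [decomposeOption_symm_apply, swap_self, ← Perm.one_def, one_mul, cycleCount_optionCongr,
        pow_succ]
    · rw [sum_comm]
      refine sum_congr rfl fun σ _ => ?_
      have h : ∀ a : α, cycleCount (decomposeOption.symm (some a, σ)) = cycleCount σ := by
        intro a
        have hn : ¬ SameCycle σ.optionCongr none (some a) := by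
          intro h
          have := SameCycle.apply_eq_of_invariant (f := Option.isSome)
            (fun x => by cases x <;> simp) h
          simp at this
        have := cycleCount_swap_mul hn
        rw [cycleCount_optionCongr] at this
        simpa using this
      simp only [h, sum_const, card_univ, nsmul_eq_mul, mul_comm]

lemma sum_sign_mul_pow_cycleCount (α : Type*) [Fintype α] [DecidableEq α] (x : R) :
    ∑ σ : Perm α, ((sign σ : ℤ) : R) * x ^ cycleCount σ =
      (-1) ^ Fintype.card α * rising (Fintype.card α) (-x) := by
  rw [← sum_pow_cycleCount, mul_sum]
  refine sum_congr rfl fun σ _ => ?_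
  rw [sign_eq_neg_one_pow_cycleCount, neg_pow x, ← mul_assoc, ← pow_add]
  push_cast
  rfl

end Rising

lemma subtypeCongrHom_subtypePerm {α : Type*} [DecidableEq α] (S : Finset α) (ζ : Perm α)
    (h : ∀ a, ζ a ∈ S ↔ a ∈ S) :
    subtypeCongrHom (· ∈ S) (subtypePerm ζ h, subtypePerm ζ fun a => not_congr (h a)) = ζ := by
  ext a
  by_cases ha : a ∈ S
  · rw [subtypeCongrHom_apply, Perm.subtypeCongr.left_apply _ _ ha]
    rfl
  · rw [subtypeCongrHom_apply, Perm.subtypeCongr.right_apply _ _ ha]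
    rfl

lemma exists_hom_eq_of_fix {α : Type*} [DecidableEq α] {S : Finset α} {ζ : Perm α}
    (h : ∀ a ∈ S, ζ a = a) :
    ∃ g : Perm {a // a ∈ S} × Perm {a // a ∉ S}, subtypeCongrHom (· ∈ S) g = ζ ∧
      sign g.1 = 1 := by
  have h' : ∀ a, ζ a ∈ S ↔ a ∈ S := by
    intro a
    by_cases ha : a ∈ S
    · rw [h a ha]
    · refine iff_of_false ?_ ha
      intro hc
      have := ζ.injective (h _ hc)
      rw [this] at hc
      exact ha hc
  refine ⟨_, subtypeCongrHom_subtypePerm S ζ h', ?_⟩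
  have : subtypePerm ζ h' = 1 := by
    ext ⟨a, ha⟩
    exact h a ha
  simp only [this, Perm.sign_one]

section SignedSum

variable {α : Type*} [Fintype α] [DecidableEq α] {R : Type*} [CommRing R]

/-- The sum of `sign (σ|S) * x ^ cycleCount (ρ * σ)` over the permutations `σ` preserving `S`. -/
noncomputable def signedSum (S : Finset α) (x : R) (ρ : Perm α) : R :=
  ∑ g : Perm {a // a ∈ S} × Perm {a // a ∉ S},
    ((sign g.1 : ℤ) : R) * x ^ cycleCount (ρ * subtypeCongrHom (· ∈ S) g)

lemma signedSum_mul_hom (S : Finset α) (x : R) (ρ : Perm α)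
    (h : Perm {a // a ∈ S} × Perm {a // a ∉ S}) :
    signedSum S x (ρ * subtypeCongrHom (· ∈ S) h) = ((sign h.1 : ℤ) : R) * signedSum S x ρ := by
  rw [signedSum, signedSum, mul_sum]
  refine Fintype.sum_equiv (Equiv.mulLeft h) _ _ fun g => ?_
  have hs : ((sign h.1 : ℤ) : R) * ((sign h.1 : ℤ) : R) = 1 := by
    rw [← Int.cast_mul, ← Units.val_mul, Int.units_mul_self]
    simp
  simp only [Equiv.coe_mulLeft, map_mul, Prod.fst_mul, Units.val_mul, Int.cast_mul]
  rw [← mul_assoc ρ, ← mul_assoc, ← mul_assoc, hs, one_mul]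

lemma signedSum_hom_mul (S : Finset α) (x : R) (ρ : Perm α)
    (h : Perm {a // a ∈ S} × Perm {a // a ∉ S}) :
    signedSum S x (subtypeCongrHom (· ∈ S) h * ρ) = ((sign h.1 : ℤ) : R) * signedSum S x ρ := by
  rw [signedSum, signedSum, mul_sum]
  refine Fintype.sum_equiv (Equiv.mulRight h) _ _ fun g => ?_
  have hs : ((sign h.1 : ℤ) : R) * ((sign h.1 : ℤ) : R) = 1 := by
    rw [← Int.cast_mul, ← Units.val_mul, Int.units_mul_self]
    simp
  simp only [Equiv.coe_mulRight, map_mul, Prod.fst_mul, Units.val_mul, Int.cast_mul]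
  rw [mul_assoc, cycleCount_mul_comm, mul_assoc ρ]
  linear_combination (-(((sign g.1 : ℤ) : R) *
    x ^ cycleCount (ρ * (subtypeCongrHom (· ∈ S) g * subtypeCongrHom (· ∈ S) h)))) * hs

lemma exists_hom_eq_of_fix_compl {S : Finset α} {ζ : Perm α} (h : ∀ a, a ∉ S → ζ a = a) :
    ∃ g : Perm {a // a ∈ S} × Perm {a // a ∉ S}, subtypeCongrHom (· ∈ S) g = ζ ∧
      sign g.1 = sign ζ := by
  have h' : ∀ a, ζ a ∈ S ↔ a ∈ S := by
    intro a
    by_cases ha : a ∈ S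
    · refine iff_of_true ?_ ha
      by_contra hc
      have := ζ.injective (h _ hc)
      rw [this] at hc
      exact hc ha
    · rw [h a ha]
  refine ⟨_, subtypeCongrHom_subtypePerm S ζ h', ?_⟩
  conv_rhs => rw [← subtypeCongrHom_subtypePerm S ζ h', subtypeCongrHom_apply, sign_subtypeCongr]
  have : (subtypePerm (p := (· ∉ S)) ζ fun a => not_congr (h' a)) = 1 := by
    ext ⟨a, ha⟩
    exact h a ha
  simp only [this, Perm.sign_one, mul_one]
  congr!

lemma signedSum_eq_zero [NoZeroDivisors R] [CharZero R] {S : Finset α} (x : R) {ρ : Perm α}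
    {a b : α} (hab : a ≠ b) (ha : a ∉ S) (hb : b ∉ S) (ha' : ρ a ∈ S) (hb' : ρ b ∈ S) :
    signedSum S x ρ = 0 := by
  obtain ⟨g, hg, hgs⟩ := exists_hom_eq_of_fix (S := S) (ζ := swap a b) fun c hc =>
    swap_apply_of_ne_of_ne (fun h => ha (h ▸ hc)) (fun h => hb (h ▸ hc))
  obtain ⟨g', hg', hgs'⟩ := exists_hom_eq_of_fix_compl (S := S) (ζ := swap (ρ a) (ρ b))
    fun c hc => swap_apply_of_ne_of_ne (fun h => hc (h ▸ ha')) (fun h => hc (h ▸ hb'))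
  have h : swap (ρ a) (ρ b) * (ρ * swap a b) = ρ := by
    rw [mul_swap_eq_swap_mul, ← mul_assoc, swap_mul_self, one_mul]
  have key := signedSum_hom_mul S x (ρ * subtypeCongrHom (· ∈ S) g) g'
  rw [signedSum_mul_hom, hg', hg, h, hgs', hgs, sign_swap (ρ.injective.ne hab)] at key
  refine self_eq_neg.1 ?_
  simpa using key

lemma mul_signedSum_swap {S : Finset α} (x : R) {a b : α} (ha : a ∈ S) (hb : b ∉ S) :
    x * signedSum S x (swap a b) =
      (-1) ^ #S * rising #S (-x) * rising (Fintype.card α - #S) x := by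
  have h1 := sum_sign_mul_pow_cycleCount {a // a ∈ S} x
  have h2 := sum_pow_cycleCount {a // a ∉ S} x
  rw [Fintype.card_coe] at h1
  rw [Fintype.card_subtype_compl, Fintype.card_coe] at h2
  rw [← h1, ← h2, signedSum, mul_sum, Fintype.sum_prod_type, sum_mul_sum]
  refine sum_congr rfl fun u _ => sum_congr rfl fun v _ => ?_
  have hn : ¬ SameCycle (subtypeCongrHom (· ∈ S) (u, v)) a b := by
    intro h
    have := SameCycle.apply_eq_of_invariant (f := fun c => c ∈ S) (fun c => by
      by_cases hc : c ∈ S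
      · simp [hc, Perm.subtypeCongr.left_apply _ _ hc]
      · simp only [hc, subtypeCongrHom_apply, Perm.subtypeCongr.right_apply _ _ hc]
        simpa using (v ⟨c, hc⟩).2) h
    simp [ha, hb] at this
  have hc := cycleCount_swap_mul hn
  have hs : cycleCount (subtypeCongrHom (· ∈ S) (u, v)) = cycleCount u + cycleCount v := by
    convert cycleCount_subtypeCongr (· ∈ S) u v
    rfl
  rw [mul_assoc, ← pow_add, ← hs, ← hc, pow_succ]
  ring

lemma signedSum_empty (x : R) (ρ : Perm α) :
    signedSum ∅ x ρ = rising (Fintype.card α) x := by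
  rw [← sum_pow_cycleCount, signedSum]
  refine Fintype.sum_bijective (fun g => ρ * subtypeCongrHom (· ∈ (∅ : Finset α)) g)
    ⟨fun g g' h => subtypeCongrHom_injective _ (mul_left_cancel h), fun σ => ?_⟩ _ _ fun g => ?_
  · exact ⟨_, (congrArg (ρ * ·) (subtypeCongrHom_subtypePerm ∅ (ρ⁻¹ * σ) (by simp))).trans
      (mul_inv_cancel_left ρ σ)⟩
  · have : IsEmpty {a // a ∈ (∅ : Finset α)} := ⟨fun a => notMem_empty _ a.2⟩
    rw [Subsingleton.elim g.1 1]
    simp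

end SignedSum

section RestrictSign

variable {α : Type*} [Fintype α] [DecidableEq α]

/-- The sign of the restriction of `ζ` to `S` if `ζ` preserves `S`, and `0` otherwise. -/
def restrictSign (S : Finset α) (ζ : Perm α) : ℤ :=
  if h : ∀ a, ζ a ∈ S ↔ a ∈ S then (sign (subtypePerm ζ h) : ℤ) else 0

lemma restrictSign_of_not {S : Finset α} {ζ : Perm α} (h : ¬ ∀ a, ζ a ∈ S ↔ a ∈ S) :
    restrictSign S ζ = 0 := dif_neg h

lemma restrictSign_eq {S : Finset α} {ζ : Perm α} (h : ∀ a, ζ a ∈ S ↔ a ∈ S) :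
    restrictSign S ζ = (sign (ofSubtype (subtypePerm ζ h)) : ℤ) := by
  rw [restrictSign, dif_pos h, sign_ofSubtype]

lemma restrictSign_union {S T : Finset α} {ζ : Perm α} (hST : Disjoint S T)
    (hS : ∀ a, ζ a ∈ S ↔ a ∈ S) (hT : ∀ a, ζ a ∈ T ↔ a ∈ T) :
    restrictSign (S ∪ T) ζ = restrictSign S ζ * restrictSign T ζ := by
  have hU : ∀ a, ζ a ∈ S ∪ T ↔ a ∈ S ∪ T := fun a => by
    rw [mem_union, mem_union, hS, hT]
  rw [restrictSign_eq hS, restrictSign_eq hT, restrictSign_eq hU, ← Units.val_mul, ← Perm.sign_mul]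
  congr 2
  ext a
  rw [Perm.mul_apply]
  by_cases haT : a ∈ T
  · have haS : ζ a ∉ S := disjoint_right.1 hST ((hT a).2 haT)
    rw [ofSubtype_apply_of_mem (p := (· ∈ S ∪ T)) _ (mem_union_right _ haT),
      ofSubtype_apply_of_mem (p := (· ∈ T)) _ haT]
    simp only [subtypePerm_apply]
    rw [ofSubtype_apply_of_not_mem (p := (· ∈ S)) _ haS]
  · rw [ofSubtype_apply_of_not_mem (p := (· ∈ T)) _ haT]
    by_cases haS : a ∈ S
    · rw [ofSubtype_apply_of_mem (p := (· ∈ S ∪ T)) _ (mem_union_left _ haS),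
        ofSubtype_apply_of_mem (p := (· ∈ S)) _ haS]
      rfl
    · rw [ofSubtype_apply_of_not_mem (p := (· ∈ S)) _ haS,
        ofSubtype_apply_of_not_mem (p := (· ∈ S ∪ T)) _ (by simp [haS, haT])]

lemma restrictSign_orbit (ζ : Perm α) (q : α) :
    restrictSign (univ.filter fun a => SameCycle ζ q a) ζ =
      -(-1) ^ #(univ.filter fun a => SameCycle ζ q a) := by
  have h : ∀ a, ζ a ∈ (univ.filter fun a => SameCycle ζ q a) ↔
      a ∈ (univ.filter fun a => SameCycle ζ q a) := by simp
  have hc : ofSubtype (subtypePerm ζ h) = ζ.cycleOf q := by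
    ext a
    rw [cycleOf_apply]
    split_ifs with ha
    · rw [ofSubtype_apply_of_mem (p := (· ∈ univ.filter fun a => SameCycle ζ q a)) _
        (by simpa using ha)]
      rfl
    · rw [ofSubtype_apply_of_not_mem (p := (· ∈ univ.filter fun a => SameCycle ζ q a)) _
        (by simpa using ha)]
  rw [restrictSign_eq h, hc]
  by_cases hq : ζ q = q
  · have h1 : (univ.filter fun a => SameCycle ζ q a) = {q} := by
      ext a
      simp only [mem_filter, mem_univ, true_and, mem_singleton]
      exact ⟨fun h => (h.eq_of_left hq).symm, fun h => h ▸ SameCycle.rfl⟩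
    rw [h1, (cycleOf_eq_one_iff ζ).2 hq]
    simp
  · have h1 : (univ.filter fun a => SameCycle ζ q a) = (ζ.cycleOf q).support := by
      ext a
      simp [mem_support_cycleOf_iff' hq]
    rw [(isCycle_cycleOf ζ hq).sign, h1]
    simp

lemma cycleCount_eq_one_iff (ζ : Perm α) (p : α) :
    cycleCount ζ = 1 ↔ ∀ q, SameCycle ζ p q := by
  rw [cycleCount_eq_card_quotient, Nat.card_eq_one_iff_exists]
  constructor
  · rintro ⟨c, hc⟩ q
    exact Quotient.exact ((hc _).trans (hc (Quotient.mk _ q)).symm)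
  · intro h
    refine ⟨Quotient.mk _ p, fun q => ?_⟩
    induction q using Quotient.inductionOn with
    | h q => exact Quotient.sound (h q).symm

lemma sum_restrictSign (ζ : Perm α) (p : α) :
    ∑ S ∈ univ.filter (fun S : Finset α => p ∉ S), (-1) ^ #S * restrictSign S ζ =
      if cycleCount ζ = 1 then 1 else 0 := by
  split_ifs with hζ
  · rw [cycleCount_eq_one_iff ζ p] at hζ
    rw [sum_eq_single ∅]
    · rw [restrictSign_eq (by simp), card_empty, pow_zero, one_mul]
      have : ofSubtype (subtypePerm (p := (· ∈ (∅ : Finset α))) ζ (by simp)) = 1 := by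
        ext a
        rw [ofSubtype_apply_of_not_mem _ (notMem_empty a)]
        rfl
      rw [this]
      simp
    · intro S hS hS0
      rw [restrictSign_of_not, mul_zero]
      intro h
      obtain ⟨a, ha⟩ := nonempty_iff_ne_empty.2 hS0
      have := SameCycle.apply_eq_of_invariant (f := (· ∈ S)) (fun a => propext (h a)) (hζ a)
      exact (mem_filter.1 hS).2 (this.mpr ha)
    · simp
  · rw [cycleCount_eq_one_iff ζ p] at hζ
    push Not at hζ
    obtain ⟨q, hq⟩ := hζ
    set O := univ.filter fun a => SameCycle ζ q a with hO
    have hOm : ∀ a, a ∈ O ↔ SameCycle ζ q a := by simp [hO]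
    have hOi : ∀ a, ζ a ∈ O ↔ a ∈ O := by simp [hOm]
    have hqO : q ∈ O := (hOm q).2 SameCycle.rfl
    have hpO : p ∉ O := fun h => hq ((hOm p).1 h).symm
    have key : ∀ S : Finset α, Disjoint S O → (∀ a, ζ a ∈ S ↔ a ∈ S) →
        (-1) ^ #S * restrictSign S ζ + (-1) ^ #(S ∪ O) * restrictSign (S ∪ O) ζ = 0 := by
      intro S hS hi
      rw [restrictSign_union hS hi hOi, restrictSign_orbit, ← hO, card_union_of_disjoint hS, pow_add]
      have : ((-1 : ℤ) ^ #O) * (-1) ^ #O = 1 := by rw [← mul_pow]; simp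
      linear_combination (-(-1) ^ #S * restrictSign S ζ) * this
    refine sum_involution (fun S _ => symmDiff S O) ?_ ?_ ?_ ?_
    · intro S _
      by_cases hi : ∀ a, ζ a ∈ S ↔ a ∈ S
      · by_cases hqS : q ∈ S
        · have hOS : O ⊆ S := by
            intro a ha
            have := SameCycle.apply_eq_of_invariant (f := (· ∈ S)) (fun a => propext (hi a))
              ((hOm a).1 ha)
            exact this.mp hqS
          have h1 : symmDiff S O = S \ O := by
            rw [symmDiff_def, sup_eq_union, sdiff_eq_empty_iff_subset.2 hOS, union_empty]
          have h2 := key (S \ O) sdiff_disjoint (fun a => by rw [mem_sdiff, mem_sdiff, hi, hOi])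
          rw [sdiff_union_of_subset hOS] at h2
          rw [h1, add_comm, h2]
        · have hOS : Disjoint S O := by
            rw [disjoint_right]
            intro a ha haS
            have := SameCycle.apply_eq_of_invariant (f := (· ∈ S)) (fun a => propext (hi a))
              ((hOm a).1 ha)
            exact hqS (this.mpr haS)
          have h1 : symmDiff S O = S ∪ O := hOS.symmDiff_eq_sup
          rw [h1, key S hOS hi]
      · have hi' : ¬ ∀ a, ζ a ∈ symmDiff S O ↔ a ∈ symmDiff S O := by
          intro h
          refine hi fun a => ?_
          have := h a
          rw [mem_symmDiff, mem_symmDiff, hOi] at this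
          tauto
        rw [restrictSign_of_not hi, restrictSign_of_not hi']
        simp
    · intro S _ _ h
      have : q ∈ symmDiff S O ↔ q ∈ S := by rw [h]
      rw [mem_symmDiff] at this
      tauto
    · intro S hS
      simp only [mem_filter, mem_univ, true_and, mem_symmDiff] at hS ⊢
      tauto
    · intro S _
      exact symmDiff_symmDiff_cancel_right _ _

variable {R : Type*} [CommRing R]

lemma signedSum_eq_sum_restrictSign (S : Finset α) (x : R) (ρ : Perm α) :
    signedSum S x ρ = ∑ ζ : Perm α, (restrictSign S ζ : R) * x ^ cycleCount (ρ * ζ) := by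
  have hinv : ∀ (g : Perm {a // a ∈ S} × Perm {a // a ∉ S}) (a : α),
      subtypeCongrHom (· ∈ S) g a ∈ S ↔ a ∈ S := by
    intro g a
    by_cases ha : a ∈ S
    · simp [ha, Perm.subtypeCongr.left_apply _ _ ha]
    · simp only [ha, subtypeCongrHom_apply, Perm.subtypeCongr.right_apply _ _ ha]
      simpa using (g.2 ⟨a, ha⟩).2
  refine sum_of_injOn (subtypeCongrHom (· ∈ S)) (subtypeCongrHom_injective _).injOn
    (by simp) ?_ ?_
  · intro ζ _ hζ
    rw [restrictSign_of_not]
    · simp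
    · intro h
      exact hζ ⟨_, by simp, subtypeCongrHom_subtypePerm S ζ h⟩
  · intro g _
    have h : restrictSign S (subtypeCongrHom (· ∈ S) g) = (sign g.1 : ℤ) := by
      rw [restrictSign, dif_pos (hinv g)]
      congr 2
      ext a
      simp
    rw [h]

lemma sum_cyclic_eq_sum_signedSum (p : α) (x : R) (ρ : Perm α) :
    ∑ ζ ∈ univ.filter (fun ζ : Perm α => cycleCount ζ = 1), x ^ cycleCount (ρ * ζ) =
      ∑ S ∈ univ.filter (fun S : Finset α => p ∉ S), (-1) ^ #S * signedSum S x ρ := by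
  simp only [signedSum_eq_sum_restrictSign, mul_sum]
  rw [sum_comm, sum_filter]
  refine sum_congr rfl fun ζ _ => ?_
  have h := congrArg (Int.cast : ℤ → R) (sum_restrictSign ζ p)
  simp only [← mul_assoc]
  rw [← sum_mul]
  push_cast at h
  rw [h]
  split_ifs <;> simp

end RestrictSign

section Rotation

variable {R : Type*} [CommRing R]

/-- The falling factorial `x (x - 1) ⋯ (x - m + 1)`. -/
def fallFact (m : ℕ) (x : R) : R := (-1) ^ m * rising m (-x)

lemma fallFact_succ (m : ℕ) (x : R) : fallFact (m + 1) x = fallFact m x * (x - m) := by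
  rw [fallFact, fallFact, rising_succ]
  ring

lemma rising_succ_sub_one (m : ℕ) (x : R) : rising (m + 1) (x - 1) = (x - 1) * rising m x := by
  rw [rising, prod_range_succ', mul_comm, rising]
  congr 1
  · simp
  · refine prod_congr rfl fun i _ => ?_
    push_cast
    ring

lemma fallFact_mul_rising (k m : ℕ) (x : R) :
    fallFact (k + 1) x * rising m x = x * rising (m + k) (x - k) := by
  induction k with
  | zero => simp [fallFact, rising]
  | succ k ih =>
    rw [fallFact_succ, mul_right_comm, ih, ← add_assoc, Nat.cast_succ, ← sub_sub,
      rising_succ_sub_one]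
    ring

lemma fallFact_eq_rising (k : ℕ) (x : R) : fallFact (k + 1) x = rising (k + 1) (x - k) := by
  have h := fallFact_mul_rising k 0 x
  rw [rising_zero, mul_one, zero_add] at h
  rw [h, rising_succ]
  ring

lemma succ_mul_rising (m : ℕ) (x : R) :
    ((m : R) + 1) * rising m x = rising (m + 1) x - rising (m + 1) (x - 1) := by
  rw [rising_succ_sub_one, rising_succ]
  ring

lemma sum_sub_mul_sub_succ (a : ℕ → R) (n : ℕ) :
    ∑ k ∈ range n, ((n : R) - k) * (a k - a (k + 1)) + ∑ k ∈ range (n + 1), a k =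
      ((n : R) + 1) * a 0 := by
  induction n with
  | zero => simp
  | succ n ih =>
    have h : ∀ k : ℕ, (((n + 1 : ℕ) : R) - k) * (a k - a (k + 1)) =
        ((n : R) - k) * (a k - a (k + 1)) + (a k - a (k + 1)) := fun k => by
      push_cast
      ring
    rw [sum_congr rfl fun k _ => h k, sum_add_distrib, sum_range_succ, sum_range_sub',
      sum_range_succ _ (n + 1)]
    push_cast
    linear_combination ih

lemma sum_range_succ_sub (a : R → R) (n : ℕ) (x : R) :
    ∑ k ∈ range n, (a (x - k) - a (x - k - 1)) = a x - a (x - n) := by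
  have := sum_range_sub' (fun k : ℕ => a (x - k)) n
  simpa [← sub_sub] using this

lemma finRotate_apply_val {n : ℕ} {i : Fin (n + 1)} (hi : (i : ℕ) < n) :
    (finRotate (n + 1) i : ℕ) = i + 1 := by
  rw [coe_finRotate_of_ne_last]
  rintro rfl
  simp at hi

lemma mul_signedSum_Icc {n : ℕ} (x : R) {i j : Fin (n + 1)} (hi : 0 < i) (hij : i ≤ j) :
    x * ((-1) ^ #(Icc i j) * signedSum (Icc i j) x (finRotate (n + 1))) =
      -(fallFact #(Icc i j) x * rising (n + 1 - #(Icc i j)) x) := by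
  have hi' : 0 < (i : ℕ) := hi
  let a : Fin (n + 1) := ⟨i - 1, by omega⟩
  have ha : a ∉ Icc i j := by
    simp only [mem_Icc, Fin.le_def, a]
    omega
  have hj : j ∈ Icc i j := by simpa using hij
  have hra : finRotate (n + 1) a = i := by
    apply Fin.ext
    rw [finRotate_apply_val (by simp only [a]; omega)]
    simp only [a]
    omega
  let w : Perm (Fin (n + 1)) := (Fin.cycleIcc i j)⁻¹ * finRotate (n + 1) * swap j a
  have hw : ∀ s ∈ Icc i j, w s = s := by
    intro s hs
    rw [mem_Icc] at hs
    simp only [w, Perm.mul_apply]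
    rw [Perm.inv_eq_iff_eq]
    by_cases hsj : s = j
    · rw [hsj, swap_apply_left, hra, Fin.cycleIcc_of_last hij]
    · have hlt : s < j := lt_of_le_of_ne hs.2 hsj
      rw [swap_apply_of_ne_of_ne hsj (fun h => ha (by rw [← h]; exact mem_Icc.2 hs)),
        Fin.cycleIcc_of_ge_of_lt hs.1 hlt, finRotate_apply]
  obtain ⟨g, hg, hgs⟩ := exists_hom_eq_of_fix hw
  obtain ⟨h, hh, hhs⟩ := exists_hom_eq_of_fix_compl (S := Icc i j) (ζ := Fin.cycleIcc i j) (by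
    intro s hs
    rw [mem_Icc, not_and_or, not_le, not_le] at hs
    exact hs.elim Fin.cycleIcc_of_lt Fin.cycleIcc_of_gt)
  have hρ : finRotate (n + 1) =
      subtypeCongrHom (· ∈ Icc i j) (h * g) * swap j a := by
    rw [map_mul, hh, hg]
    simp only [w]
    group
    simp
  have hs : sign (h * g).1 = (-1) ^ (j - i : ℕ) := by
    rw [Prod.fst_mul, Perm.sign_mul, hgs, hhs, Fin.sign_cycleIcc_of_le hij, mul_one]
  have hcard : #(Icc i j) = (j - i : ℕ) + 1 := by
    rw [Fin.card_Icc]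
    have : (i : ℕ) ≤ j := hij
    omega
  have key := mul_signedSum_swap x hj ha
  conv_lhs => rw [hρ]
  rw [signedSum_hom_mul, hs]
  rw [Fintype.card_fin] at key
  have hsq : ((-1 : R) ^ (j - i : ℕ)) * (-1) ^ (j - i : ℕ) = 1 := by rw [← mul_pow]; simp
  rw [fallFact, ← key]
  generalize signedSum (Icc i j) x (swap j a) = T
  rw [hcard]
  push_cast
  rw [pow_succ]
  linear_combination (-x * T) * hsq

lemma signedSum_finRotate_eq_zero [NoZeroDivisors R] [CharZero R] {n : ℕ} (x : R)
    {S : Finset (Fin (n + 1))} (hS : S.Nonempty) (h0 : 0 ∉ S)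
    (h : S ≠ Icc (S.min' hS) (S.max' hS)) : signedSum S x (finRotate (n + 1)) = 0 := by
  set i := S.min' hS with hi
  set j := S.max' hS with hj
  have hsub : S ⊆ Icc i j := fun s hs => mem_Icc.2 ⟨S.min'_le s hs, S.le_max' s hs⟩
  have hB : (Icc i j \ S).Nonempty := by
    rw [sdiff_nonempty]
    exact fun h' => h (hsub.antisymm h')
  have hiS : i ∈ S := S.min'_mem hS
  have hjS : j ∈ S := S.max'_mem hS
  have hi0 : 0 < (i : ℕ) := by
    rw [Nat.pos_iff_ne_zero]
    intro hc
    exact h0 (by rwa [show i = 0 from Fin.ext hc] at hiS)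
  set m := (Icc i j \ S).max' hB with hm
  have hmB : m ∈ Icc i j \ S := max'_mem _ _
  rw [mem_sdiff, mem_Icc] at hmB
  have hmj : (m : ℕ) < j := lt_of_le_of_ne hmB.1.2 fun hc =>
    hmB.2 (by rwa [Fin.ext hc])
  have hm1 : (finRotate (n + 1) m : ℕ) = m + 1 := finRotate_apply_val (by omega)
  have hmS : finRotate (n + 1) m ∈ S := by
    by_contra hc
    have h1 : finRotate (n + 1) m ∈ Icc i j \ S := by
      rw [mem_sdiff, mem_Icc, Fin.le_def, Fin.le_def, hm1]
      have h2 : (i : ℕ) ≤ m := hmB.1.1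
      exact ⟨by omega, hc⟩
    have h2 : (finRotate (n + 1) m : ℕ) ≤ m := le_max' _ _ h1
    omega
  let a : Fin (n + 1) := ⟨i - 1, by omega⟩
  have hai : finRotate (n + 1) a = i := by
    apply Fin.ext
    rw [finRotate_apply_val (by simp only [a]; omega)]
    simp only [a]
    omega
  have haS : a ∉ S := by
    intro hc
    have : (i : ℕ) ≤ a := S.min'_le a hc
    simp only [a] at this
    omega
  refine signedSum_eq_zero x (a := m) (b := a) ?_ hmB.2 haS hmS (hai ▸ hiS)
  intro hc
  have h1 : (m : ℕ) = i - 1 := congrArg Fin.val hc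
  have h2 : (i : ℕ) ≤ m := hmB.1.1
  omega

lemma sum_signedSum_finRotate [NoZeroDivisors R] [CharZero R] (n : ℕ) (x : R) :
    x * ∑ S ∈ univ.filter (fun S : Finset (Fin (n + 1)) => 0 ∉ S),
        (-1) ^ #S * signedSum S x (finRotate (n + 1)) =
      x * rising (n + 1) x -
        ∑ k ∈ range n, ((n : R) - k) * (fallFact (k + 1) x * rising (n - k) x) := by
  rw [← add_sum_erase _ _ (a := ∅) (by simp), signedSum_empty, card_empty, pow_zero, one_mul,
    Fintype.card_fin, mul_add, sub_eq_add_neg]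
  congr 1
  have hIcc : ∀ s k : ℕ, s + k < n → ∀ (h1 : s + 1 < n + 1) (h2 : s + 1 + k < n + 1),
      univ.filter (fun a : Fin (n + 1) => s + 1 ≤ (a : ℕ) ∧ (a : ℕ) ≤ s + 1 + k) =
        Icc (⟨s + 1, h1⟩ : Fin (n + 1)) ⟨s + 1 + k, h2⟩ := by
    intro s k _ h1 h2
    ext a
    simp [Fin.le_def]
  have hmem : ∀ q ∈ (range n).sigma fun k => range (n - k), q.2 + q.1 < n := by
    intro q hq
    rw [mem_sigma, mem_range, mem_range] at hq
    omega
  rw [mul_sum, ← sum_of_injOn (s := (range n).sigma fun k => range (n - k))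
    (f := fun q => -(fallFact (q.1 + 1) x * rising (n - q.1) x))
    (fun q => univ.filter fun a : Fin (n + 1) =>
      q.2 + 1 ≤ (a : ℕ) ∧ (a : ℕ) ≤ q.2 + 1 + q.1)]
  · rw [sum_sigma, ← sum_neg_distrib]
    refine sum_congr rfl fun k hk => ?_
    simp only [sum_const, card_range]
    rw [nsmul_eq_mul, Nat.cast_sub (mem_range.1 hk).le]
    ring
  · rintro ⟨k, s⟩ hq ⟨k', s'⟩ hq' h
    have h1 := hmem _ hq
    have h2 := hmem _ hq'
    simp only at h1 h2
    have e := fun (a : ℕ) (ha : a < n + 1) =>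
      congrArg (fun S : Finset (Fin (n + 1)) => (⟨a, ha⟩ : Fin (n + 1)) ∈ S) h
    simp only [mem_filter, mem_univ, true_and, eq_iff_iff] at e
    have e1 := e (s + 1) (by omega)
    have e2 := e (s' + 1) (by omega)
    have e3 := e (s + 1 + k) (by omega)
    have e4 := e (s' + 1 + k') (by omega)
    have hs : s = s' := by omega
    have hk : k = k' := by omega
    subst hs hk
    rfl
  · rintro ⟨k, s⟩ hq
    have h1 := hmem _ hq
    simp only at h1
    simp only [coe_erase, coe_filter, mem_univ, true_and, Set.mem_sdiff, Set.mem_ofPred_eq,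
      Set.mem_singleton_iff, mem_filter, Fin.val_zero]
    refine ⟨by omega, fun h => ?_⟩
    have : (⟨s + 1, by omega⟩ : Fin (n + 1)) ∈ (∅ : Finset (Fin (n + 1))) := by
      rw [← h]
      simp
    exact notMem_empty _ this
  · intro S hS hS'
    rw [mem_erase, mem_filter] at hS
    have hne := nonempty_iff_ne_empty.2 hS.1
    rw [signedSum_finRotate_eq_zero x hne hS.2.2, mul_zero, mul_zero]
    intro h
    have hi0 : 0 < (S.min' hne : ℕ) := by
      rw [Nat.pos_iff_ne_zero]
      intro hc
      have := S.min'_mem hne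
      rw [show S.min' hne = 0 from Fin.ext hc] at this
      exact hS.2.2 this
    have hij : (S.min' hne : ℕ) ≤ S.max' hne := S.min'_le _ (S.max'_mem hne)
    have hj := (S.max' hne).2
    refine hS' ⟨⟨S.max' hne - S.min' hne, S.min' hne - 1⟩, ?_, ?_⟩
    · rw [mem_coe, mem_sigma, mem_range, mem_range]
      simp only
      omega
    · conv_rhs => rw [h]
      ext a
      simp only [mem_filter, mem_univ, true_and, mem_Icc, Fin.le_def]
      omega
  · rintro ⟨k, s⟩ hq
    have h1 := hmem _ hq
    simp only at h1
    simp only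
    rw [hIcc s k h1 (by omega) (by omega), mul_signedSum_Icc x (by simp [Fin.lt_def])
      (by simp [Fin.le_def])]
    have hc : #(Icc (⟨s + 1, by omega⟩ : Fin (n + 1)) ⟨s + 1 + k, by omega⟩) = k + 1 := by
      rw [Fin.card_Icc]
      simp only
      omega
    rw [hc]
    congr 3
    omega

lemma sum_cyclic_finRotate [IsDomain R] [CharZero R] (n : ℕ) {x : R} (hx : x ≠ 0) :
    ((n : R) + 2) * ((n : R) + 1) *
      ∑ ζ ∈ univ.filter (fun ζ : Perm (Fin (n + 1)) => cycleCount ζ = 1),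
        x ^ cycleCount (finRotate (n + 1) * ζ) =
      rising (n + 2) x - fallFact (n + 2) x := by
  have h := sum_signedSum_finRotate n x
  rw [← sum_cyclic_eq_sum_signedSum] at h
  set F := ∑ ζ ∈ univ.filter (fun ζ : Perm (Fin (n + 1)) => cycleCount ζ = 1),
        x ^ cycleCount (finRotate (n + 1) * ζ)
  have h1 : ∀ k ∈ range n, ((n : R) - k) * (fallFact (k + 1) x * rising (n - k) x) =
      x * (((n : R) - k) * rising n (x - k)) := by
    intro k hk
    have hk' : n - k + k = n := by
      have := mem_range.1 hk
      omega
    rw [fallFact_mul_rising, hk']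
    ring
  rw [sum_congr rfl h1, ← mul_sum, ← mul_sub] at h
  have h2 := mul_left_cancel₀ hx h
  have h3 := sum_sub_mul_sub_succ (fun k : ℕ => rising (n + 1) (x - k)) n
  have h4 : ∀ k ∈ range n, ((n : R) - k) *
      (rising (n + 1) (x - k) - rising (n + 1) (x - (k + 1 : ℕ))) =
        ((n : R) + 1) * (((n : R) - k) * rising n (x - k)) := by
    intro k _
    rw [Nat.cast_succ, ← sub_sub, ← succ_mul_rising]
    ring
  rw [sum_congr rfl h4, ← mul_sum, Nat.cast_zero, sub_zero] at h3
  have h5 := sum_range_succ_sub (rising (n + 1 + 1)) (n + 1) x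
  simp only [← fallFact_eq_rising, ← succ_mul_rising (n + 1), ← mul_sum] at h5
  push_cast at h5
  linear_combination ((n : R) + 2) * ((n : R) + 1) * h2 + h5 - ((n : R) + 2) * h3

lemma rising_sub_fallFact_recurrence (m : ℕ) (x : R) :
    (m : R) * (rising (m + 2) x - fallFact (m + 2) x) =
      (2 * m + 1) * x * (rising (m + 1) x - fallFact (m + 1) x) +
        (m + 1) * ((m : R) ^ 2 - x ^ 2) * (rising m x - fallFact m x) := by
  rw [rising_succ, rising_succ, fallFact_succ, fallFact_succ]
  push_cast
  ring

end Rotation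

lemma cycleCount_pos {α : Type*} [Fintype α] [DecidableEq α] [Nonempty α] (σ : Perm α) :
    0 < cycleCount σ := by
  have : Nonempty (Quotient (SameCycle.setoid σ)) := ‹Nonempty α›.map (Quotient.mk _)
  rw [cycleCount_eq_card_quotient]
  exact Nat.card_pos

lemma even_add_cycleCount_finRotate_mul {n : ℕ} {ζ : Perm (Fin (n + 1))} (hζ : cycleCount ζ = 1) :
    Even (n + 1 + cycleCount (finRotate (n + 1) * ζ)) := by
  have h := sign_eq_neg_one_pow_cycleCount (finRotate (n + 1) * ζ)
  rw [Perm.sign_mul, sign_finRotate, add_tsub_cancel_right, sign_eq_neg_one_pow_cycleCount ζ, hζ, Fintype.card_fin,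
    ← pow_add] at h
  have h1 : Even (n + (n + 1 + 1)) := ⟨n + 1, by ring⟩
  rw [h1.neg_one_pow] at h
  by_contra hc
  rw [(Nat.not_even_iff_odd.1 hc).neg_one_pow] at h
  exact absurd h (by decide)

lemma sum_cyclic_eq_mul_expand_Pn (n : ℕ) :
    ∑ ζ ∈ univ.filter (fun ζ : Perm (Fin (n + 1)) => cycleCount ζ = 1),
        (X : ℝ[X]) ^ cycleCount (finRotate (n + 1) * ζ) =
      X ^ (if Even n then 1 else 2) * expand ℝ 2 (Pn n) := by
  rw [Pn, map_sum, mul_sum]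
  refine sum_congr rfl fun ζ hζ => ?_
  have h1 := even_add_cycleCount_finRotate_mul (mem_filter.1 hζ).2
  have h2 := cycleCount_pos (finRotate (n + 1) * ζ)
  rw [map_pow, expand_X, ← pow_mul, ← pow_add]
  congr 1
  split_ifs with hn
  · rw [Nat.even_iff] at h1 hn
    omega
  · rw [Nat.even_iff] at h1 hn
    omega

lemma mul_expand_Pn (n : ℕ) :
    ((n : ℝ[X]) + 2) * ((n : ℝ[X]) + 1) * (X ^ (if Even n then 1 else 2) * expand ℝ 2 (Pn n)) =
      rising (n + 2) X - fallFact (n + 2) X := by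
  rw [← sum_cyclic_eq_mul_expand_Pn]
  exact sum_cyclic_finRotate n X_ne_zero

lemma Pn_zero : Pn 0 = 1 := by
  apply expand_injective two_pos
  have h := mul_expand_Pn 0
  simp only [Even.zero, if_true, fallFact_succ, rising_succ] at h
  simp [rising, fallFact] at h
  rw [map_one]
  apply mul_left_cancel₀ (mul_ne_zero two_ne_zero X_ne_zero : (2 : ℝ[X]) * X ≠ 0)
  linear_combination h

lemma Pn_one : Pn 1 = 1 := by
  apply expand_injective two_pos
  have h := mul_expand_Pn 1
  rw [if_neg (by decide)] at h
  simp only [fallFact_succ, rising_succ] at h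
  simp [rising, fallFact] at h
  rw [map_one]
  apply mul_left_cancel₀ (mul_ne_zero (by norm_num) (pow_ne_zero 2 X_ne_zero) :
    (6 : ℝ[X]) * X ^ 2 ≠ 0)
  linear_combination h

lemma Pn_add_two (m : ℕ) :
    ((m : ℝ[X]) + 4) * Pn (m + 2) =
      (2 * (m : ℝ[X]) + 5) * X ^ (if Even m then 1 else 0) * Pn (m + 1) +
        ((m : ℝ[X]) + 1) * (((m : ℝ[X]) + 2) ^ 2 - X) * Pn m := by
  apply expand_injective two_pos
  have h0 := mul_expand_Pn m
  have h1 := mul_expand_Pn (m + 1)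
  have h2 := mul_expand_Pn (m + 2)
  have hr := rising_sub_fallFact_recurrence (m + 2) (X : ℝ[X])
  have e2 : Even (m + 2) ↔ Even m := by simp [Nat.even_add]
  rw [← h2, ← h1, ← h0] at hr
  simp only [map_mul, map_add, map_sub, map_pow, map_natCast, map_ofNat, map_one, expand_X]
  simp only [e2, Nat.even_add_one, ite_not] at hr
  push_cast at hr
  have hm2 : (m : ℝ[X]) + 2 ≠ 0 := mod_cast (Nat.succ_ne_zero (m + 1))
  have hm3 : (m : ℝ[X]) + 3 ≠ 0 := mod_cast (Nat.succ_ne_zero (m + 2))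
  apply mul_left_cancel₀ (mul_ne_zero (mul_ne_zero hm2 hm3)
    (pow_ne_zero (if Even m then 1 else 2) X_ne_zero))
  split_ifs at hr ⊢ <;> linear_combination hr

/-- `P_0 = P_1 = 1` and `(n+2)·P_n(z) = (2n+1)·z^{e(n)}·P_{n-1}(z) + (n-1)(n²-z)·P_{n-2}(z)`
for `n ≥ 2`, where `e(n) = 1` if `n` is even and `e(n) = 0` if `n` is odd. -/
theorem stmt_16 :
    Pn 0 = 1 ∧ Pn 1 = 1 ∧
    ∀ n : ℕ, 2 ≤ n →
      ((n : Polynomial ℝ) + 2) * Pn n =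
        (2 * (n : Polynomial ℝ) + 1) * Polynomial.X ^ (if Even n then 1 else 0) * Pn (n - 1)
          + ((n : Polynomial ℝ) - 1) * ((n : Polynomial ℝ) ^ 2 - Polynomial.X) * Pn (n - 2) := by
  refine ⟨Pn_zero, Pn_one, fun n hn => ?_⟩
  obtain ⟨m, rfl⟩ := Nat.exists_eq_add_of_le' hn
  have e2 : Even (m + 2) ↔ Even m := by simp [Nat.even_add]
  have h := Pn_add_two m
  rw [Nat.add_sub_cancel, show m + 2 - 1 = m + 1 from rfl]
  simp only [e2]
  push_cast
  linear_combination h
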